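/- For any real X, X is Martin-Löf BP random if and only if X is martingale BP random. -/

import Mathlib

namespace BP



/-- The finite binary string `(X 0, …, X (n−1))`. -/
def take (X : ℕ → Bool) (n : ℕ) : List Bool := (List.range n).map X

/-- `X ∈ [G]`: the real `X` extends some string of the finite set (list) `G`. -/
def Mem (X : ℕ → Bool) (G : List (List Bool)) : Prop :=
  ∃ τ ∈ G, take X τ.length = τ

/-- The maximum length of a string in `G`. -/
def maxLen (G : List (List Bool)) : ℕ := (G.map List.length).foldr max 0

/-- The list of all binary strings of length `L`. -/
def allStrings (L : ℕ) : List (List Bool) :=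
  (List.range (2 ^ L)).map fun k => (List.range L).map fun i => k.testBit i

/-- The uniform (fair-coin) measure of the clopen set `[G]`, computed by counting
which strings of length `maxLen G` extend a member of `G`. -/
def mu (G : List (List Bool)) : ℚ :=
  (((allStrings (maxLen G)).filter fun σ => G.any fun τ => decide (τ <+: σ)).length : ℚ)
    / 2 ^ maxLen G

/-- The uniform measure of `[G] ∩ [τ]`. -/
def muCap (G : List (List Bool)) (τ : List Bool) : ℚ :=
  (((allStrings (max (maxLen G) τ.length)).filter fun σ =>
      decide (τ <+: σ) && (G.any fun ρ => decide (ρ <+: σ))).length : ℚ)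
    / 2 ^ max (maxLen G) τ.length

/-- A primitive recursive test: a primitive recursive sequence of finite sets of
binary strings with `μ([Gₙ]) ≤ 2⁻ⁿ`. -/
def IsTest (G : ℕ → List (List Bool)) : Prop :=
  Primrec G ∧ ∀ n, mu (G n) ≤ ((2 : ℚ) ^ n)⁻¹

/-- `X` is Martin-Löf BP random. -/
def MLBPRandom (X : ℕ → Bool) : Prop :=
  ∀ G : ℕ → List (List Bool), IsTest G → ∃ n, ¬ Mem X (G n)

/-- A weak primitive recursive test. -/
def IsWeakTest (G : ℕ → List (List Bool)) : Prop :=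
  IsTest G ∧ ∃ ℓ : ℕ → ℕ, Primrec ℓ ∧ (∀ n, ∀ τ ∈ G n, τ.length = ℓ n) ∧
    ∀ n, ∀ τ ∈ G n, muCap (G (n + 1)) τ ≤ (1 / 2) * ((2 : ℚ) ^ τ.length)⁻¹

/-- A martingale with values in the nonnegative rationals. -/
def IsMartingale (d : List Bool → ℚ) : Prop :=
  d [] = 1 ∧ (∀ σ, 0 ≤ d σ) ∧
    ∀ σ, d σ = (d (σ ++ [false]) + d (σ ++ [true])) / 2

/-- The martingale `d` succeeds primitive recursively on `X`. -/
def SucceedsPR (d : List Bool → ℚ) (X : ℕ → Bool) : Prop :=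
  ∃ f : ℕ → ℕ, Primrec f ∧ ∀ n, (2 : ℚ) ^ n ≤ d (take X (f n))

/-- `X` is martingale BP random. -/
def MartingaleBPRandom (X : ℕ → Bool) : Prop :=
  ¬ ∃ d : List Bool → ℚ, Primrec d ∧ IsMartingale d ∧ SucceedsPR d X

/-- `X` is primitive recursively compressed by the machine `M`. -/
def CompressedBy (M : List Bool → List Bool) (X : ℕ → Bool) : Prop :=
  ∃ f : ℕ → ℕ, Primrec f ∧
    ∀ c, ∃ σ : List Bool, σ.length ≤ f c - c ∧ M σ = take X (f c)

/-- `X` is Kolmogorov BP random. -/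
def KolmogorovBPRandom (X : ℕ → Bool) : Prop :=
  ¬ ∃ M : List Bool → List Bool, Primrec M ∧ CompressedBy M X

/-- `M` is a (total) process machine: it is extension preserving. -/
def IsProcessMachine (M : List Bool → List Bool) : Prop :=
  ∀ σ τ : List Bool, σ <+: τ → M σ <+: M τ

/-- `M` is a quick process BP machine. -/
def IsQuickProcessBP (M : List Bool → List Bool) : Prop :=
  Primrec M ∧ IsProcessMachine M ∧
    ∃ h : ℕ → ℕ, Primrec h ∧ Monotone h ∧ (∀ k, ∃ n, k ≤ h n) ∧
      ∀ τ : List Bool, h τ.length ≤ (M τ).length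

/-- `X` is quick process BP random. -/
def QuickProcessBPRandom (X : ℕ → Bool) : Prop :=
  ¬ ∃ M : List Bool → List Bool, IsQuickProcessBP M ∧ CompressedBy M X

/-- The number of `i < n` with `X i = true`. -/
def cardBelow (X : ℕ → Bool) (n : ℕ) : ℕ := (List.range n).countP X

section RatPrimrec

open Encodable Denumerable

/-- The code of an integer. -/
def intCode (z : ℤ) : ℕ := @encode ℤ Primcodable.toEncodable z

/-- The code of a rational, its index in the enumeration of `ℚ`. -/
def ratIndex (q : ℚ) : ℕ := @encode ℚ Primcodable.toEncodable q

theorem ofNat_ratIndex (q : ℚ) : ofNat ℚ (ratIndex q) = q := ofNat_encode q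

theorem intCode_ofNat (n : ℕ) : intCode (ofNat ℤ n) = n := encode_ofNat n

theorem primrec_intCode : Primrec intCode := Primrec.encode

theorem primrec_ratIndex : Primrec ratIndex := Primrec.encode

/-- The pair of (the code of) the numerator and the denominator of a rational. -/
def ratCode (q : ℚ) : ℕ := Nat.pair (intCode q.num) q.den

theorem ratCode_eq_encode (q : ℚ) : ratCode q = @encode ℚ Rat.instEncodable q := by
  cases q; rfl

theorem intCode_natCast (n : ℕ) : intCode (n : ℤ) = 2 * n := by
  rfl

theorem intCode_negSucc (n : ℕ) : intCode (Int.negSucc n) = 2 * n + 1 := by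
  rfl

/-- The `n`-th code of a rational. -/
def nthRatCode (n : ℕ) : ℕ := ratCode (ofNat ℚ n)

theorem nthRatCode_ratIndex (q : ℚ) : nthRatCode (ratIndex q) = ratCode q := by
  rw [nthRatCode, ofNat_ratIndex]

theorem nthRatCode_strictMono : StrictMono nthRatCode := by
  refine strictMono_nat_of_lt_succ fun n => ?_
  unfold nthRatCode
  rw [ratCode_eq_encode, ratCode_eq_encode]
  let _ := @Encodable.decidableRangeEncode ℚ Rat.instEncodable
  have _ : Infinite (Set.range (@encode ℚ Rat.instEncodable)) :=
    Infinite.of_injective _ (Equiv.ofInjective _ encode_injective).injective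
  have h : ∀ n, @encode ℚ Rat.instEncodable (ofNat ℚ n) =
      (Nat.Subtype.ofNat (Set.range (@encode ℚ Rat.instEncodable)) n : ℕ) := by
    intro n
    have : ofNat ℚ n =
        (@equivRangeEncode ℚ Rat.instEncodable).symm (Nat.Subtype.ofNat _ n) := by
      unfold Rat.instDenumerable Denumerable.ofEncodableOfInfinite
      erw [Denumerable.ofEquiv_ofNat]
      rfl
    rw [this]
    exact congrArg Subtype.val ((@equivRangeEncode ℚ Rat.instEncodable).apply_symm_apply
      (Nat.Subtype.ofNat (Set.range (@encode ℚ Rat.instEncodable)) n))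
  rw [h, h]
  exact Nat.Subtype.lt_succ_self _

theorem ratIndex_lt_ratIndex_iff {p q : ℚ} : ratIndex p < ratIndex q ↔ ratCode p < ratCode q := by
  simpa only [nthRatCode_ratIndex] using (nthRatCode_strictMono.lt_iff_lt (a := ratIndex p) (b := ratIndex q)).symm

theorem ratIndex_le_ratCode (q : ℚ) : ratIndex q ≤ ratCode q := by
  simpa only [nthRatCode_ratIndex] using nthRatCode_strictMono.le_apply (x := ratIndex q)

/-- The absolute value of the integer with code `z`. -/
def codeAbs (z : ℕ) : ℕ := if z % 2 = 0 then z / 2 else z / 2 + 1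

theorem codeAbs_intCode (z : ℤ) : codeAbs (intCode z) = z.natAbs := by
  rcases z with n | n
  · have := intCode_natCast n
    simp only [Int.ofNat_eq_natCast, this, codeAbs]; simp
  · rw [intCode_negSucc, codeAbs]
    rw [if_neg (by lia)]; simp; lia

/-- The natural number `e` is of the form `ratCode q`. -/
def IsRatCode (e : ℕ) : Prop :=
  0 < e.unpair.2 ∧
    ∀ x < e.unpair.2 + 1, x = 1 ∨ e.unpair.2 % x ≠ 0 ∨ codeAbs e.unpair.1 % x ≠ 0

theorem isRatCode_iff (e : ℕ) : IsRatCode e ↔ ∃ q, ratCode q = e := by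
  have key : IsRatCode e ↔ 0 < e.unpair.2 ∧ (codeAbs e.unpair.1).Coprime e.unpair.2 := by
    refine and_congr_right fun h => ⟨fun H => ?_, fun H x _ => ?_⟩
    · refine Nat.coprime_of_dvd' fun k hk h1 h2 => ?_
      have := H k (Nat.lt_succ_of_le (Nat.le_of_dvd h h2))
      rcases this with h3 | h3 | h3
      · simp [h3]
      · exact absurd (Nat.mod_eq_zero_of_dvd h2) h3
      · exact absurd (Nat.mod_eq_zero_of_dvd h1) h3
    · by_contra! hc
      exact hc.1 (Nat.eq_one_of_dvd_coprimes H (Nat.dvd_of_mod_eq_zero hc.2.2)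
        (Nat.dvd_of_mod_eq_zero hc.2.1))
  rw [key]
  constructor
  · rintro ⟨h1, h2⟩
    refine ⟨⟨ofNat ℤ e.unpair.1, e.unpair.2, h1.ne', ?_⟩, ?_⟩
    · rwa [← codeAbs_intCode, intCode_ofNat]
    · simp only [ratCode, intCode_ofNat, Nat.pair_unpair]
  · rintro ⟨q, rfl⟩
    simpa [ratCode, codeAbs_intCode, q.pos] using q.reduced

theorem primrecPred_isRatCode : PrimrecPred IsRatCode := by
  have habs : Primrec codeAbs :=
    Primrec.ite (Primrec.eq.comp (Primrec.nat_mod.comp Primrec.id (.const 2)) (.const 0))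
      (Primrec.nat_div.comp .id (.const 2))
      (Primrec.succ.comp (Primrec.nat_div.comp .id (.const 2)))
  have h2 : Primrec fun e : ℕ => e.unpair.2 := Primrec.snd.comp Primrec.unpair
  have h1 : Primrec fun e : ℕ => codeAbs e.unpair.1 :=
    habs.comp (Primrec.fst.comp Primrec.unpair)
  refine PrimrecPred.and (Primrec.nat_lt.comp (.const 0) h2) ?_
  have : PrimrecRel fun x e : ℕ => x = 1 ∨ e.unpair.2 % x ≠ 0 ∨ codeAbs e.unpair.1 % x ≠ 0 := by
    refine PrimrecPred.primrecRel (p := fun y : ℕ × ℕ => y.1 = 1 ∨ y.2.unpair.2 % y.1 ≠ 0 ∨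
      codeAbs y.2.unpair.1 % y.1 ≠ 0) (PrimrecPred.or ?_ (PrimrecPred.or ?_ ?_))
    · exact Primrec.eq.comp .fst (.const 1)
    · exact (Primrec.eq.comp (Primrec.nat_mod.comp (h2.comp .snd) .fst) (.const 0)).not
    · exact (Primrec.eq.comp (Primrec.nat_mod.comp (h1.comp .snd) .fst) (.const 0)).not
  exact this.forall_lt.comp (Primrec.succ.comp h2) .id

theorem primrec_ratCode : Primrec ratCode := by
  classical
  have hg : Primrec nthRatCode := by
    refine Primrec.of_graph ⟨fun n => Nat.pair (2 * n) 1,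
      Primrec₂.natPair.comp Primrec.nat_double (.const 1), fun n => ?_⟩ ?_
    · have hc : ∀ n : ℕ, ratCode (n : ℚ) = Nat.pair (2 * n) 1 := fun n => by
        simp [ratCode, intCode_natCast]
      have hm : StrictMono fun n : ℕ => ratIndex (n : ℚ) := strictMono_nat_of_lt_succ fun n => by
        rw [ratIndex_lt_ratIndex_iff, hc, hc]
        exact Nat.pair_lt_pair_left _ (by lia)
      have := nthRatCode_strictMono.monotone (hm.le_apply (x := n))
      rwa [nthRatCode_ratIndex, hc] at this
    · have hcount : Primrec fun e => ((List.range e).filter fun x => IsRatCode x).length :=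
        Primrec.list_length.comp ((Primrec.listFilter primrecPred_isRatCode).comp
          Primrec.list_range)
      refine PrimrecRel.of_eq (r := fun n e => IsRatCode e ∧
        ((List.range e).filter fun x => IsRatCode x).length = n) (PrimrecPred.primrecRel
          (PrimrecPred.and (primrecPred_isRatCode.comp .snd)
            (Primrec.eq.comp (hcount.comp Primrec.snd) Primrec.fst))) fun n e => ?_
      have hlen : ∀ n, ((List.range (nthRatCode n)).filter
          fun x => IsRatCode x).length = n := by
        intro n
        rw [← List.countP_eq_length_filter]
        change Nat.count _ _ = _
        rw [Nat.count_eq_card_filter_range]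
        have : (Finset.range (nthRatCode n)).filter IsRatCode =
            (Finset.range n).image nthRatCode := by
          ext x
          simp only [Finset.mem_filter, Finset.mem_range, Finset.mem_image, isRatCode_iff]
          constructor
          · rintro ⟨hx, q, rfl⟩
            refine ⟨ratIndex q, ?_, nthRatCode_ratIndex q⟩
            rw [← nthRatCode_ratIndex q] at hx
            exact nthRatCode_strictMono.lt_iff_lt.1 hx
          · rintro ⟨m, hm, rfl⟩
            exact ⟨nthRatCode_strictMono hm, _, rfl⟩
        rw [this, Finset.card_image_of_injective _ nthRatCode_strictMono.injective,
          Finset.card_range]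
      constructor
      · rintro ⟨he, hn⟩
        obtain ⟨q, rfl⟩ := (isRatCode_iff e).1 he
        have := hlen (ratIndex q)
        rw [nthRatCode_ratIndex, hn] at this
        rw [this, nthRatCode_ratIndex]
      · rintro rfl
        exact ⟨(isRatCode_iff _).2 ⟨_, rfl⟩, hlen n⟩
  exact (hg.comp primrec_ratIndex).of_eq nthRatCode_ratIndex

theorem primrec_den : Primrec Rat.den :=
  (Primrec.snd.comp (Primrec.unpair.comp primrec_ratCode)).of_eq fun q => by simp [ratCode]

theorem primrec_intCode_num : Primrec fun q : ℚ => intCode q.num :=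
  (Primrec.fst.comp (Primrec.unpair.comp primrec_ratCode)).of_eq fun q => by simp [ratCode]

theorem primrec_num : Primrec Rat.num :=
  Primrec.encode_iff.1 primrec_intCode_num

theorem primrec_toNat : Primrec Int.toNat := by
  refine (Primrec.ite (Primrec.eq.comp (Primrec.nat_mod.comp primrec_intCode (.const 2))
    (.const 0)) (Primrec.nat_div.comp primrec_intCode (.const 2)) (.const 0)).of_eq fun z => ?_
  rcases z with n | n
  · have := intCode_natCast n
    simp only [Int.ofNat_eq_natCast, this]; simp
  · rw [intCode_negSucc, if_neg (by lia)]; simp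

theorem primrecRel_natCast_le_of_pos :
    PrimrecRel fun (a : ℕ) (q : ℚ) => ((a + 1 : ℕ) : ℚ) ≤ q := by
  refine PrimrecRel.of_eq (r := fun a q => (a + 1) * q.den ≤ q.num.toNat)
    (PrimrecPred.primrecRel
    (Primrec.nat_le.comp (Primrec.nat_mul.comp (Primrec.succ.comp .fst) (primrec_den.comp .snd))
      (primrec_toNat.comp (primrec_num.comp .snd)))) fun a q => ?_
  have hd : (0 : ℚ) < q.den := by exact_mod_cast q.pos
  have : ((a + 1 : ℕ) : ℚ) ≤ q ↔ (((a + 1) * q.den : ℕ) : ℤ) ≤ q.num := by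
    conv_lhs => rw [← Rat.num_div_den q, le_div_iff₀ hd]
    exact_mod_cast Iff.rfl
  rw [this]
  have := Nat.mul_pos a.succ_pos q.pos
  simp only [Nat.succ_eq_add_one] at this
  lia

theorem ratCode_natCast_div_le (a b : ℕ) :
    ratCode ((a : ℚ) / ((b + 1 : ℕ) : ℚ)) ≤ Nat.pair (2 * a) (b + 1) := by
  set q : ℚ := (a : ℚ) / ((b + 1 : ℕ) : ℚ) with hq
  have hb : (0 : ℚ) < ((b + 1 : ℕ) : ℚ) := by positivity
  have hq0 : 0 ≤ q := by positivity
  have hden : q.den ≤ b + 1 := by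
    have := Rat.den_dvd (a : ℤ) ((b + 1 : ℕ) : ℤ)
    rw [Rat.divInt_eq_div, Int.cast_natCast, Int.cast_natCast, ← hq] at this
    exact Nat.le_of_dvd b.succ_pos (Int.natCast_dvd_natCast.1 this)
  have hnum : q.num ≤ a := by
    have h1 : (q.num : ℚ) = q * q.den := (Rat.mul_den_eq_num q).symm
    have h2 : q * q.den ≤ q * ((b + 1 : ℕ) : ℚ) :=
      mul_le_mul_of_nonneg_left (by exact_mod_cast hden) hq0
    have h3 : q * ((b + 1 : ℕ) : ℚ) = a := div_mul_cancel₀ _ hb.ne'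
    rw [← h1, h3] at h2
    exact_mod_cast h2
  obtain ⟨m, hm⟩ := Int.eq_ofNat_of_zero_le (Rat.num_nonneg.2 hq0)
  rw [ratCode, hm, intCode_natCast]
  rw [hm] at hnum
  have h1 : StrictMono fun x => Nat.pair x q.den := fun x y h => Nat.pair_lt_pair_left _ h
  have h2 : StrictMono fun y => Nat.pair (2 * a) y := fun x y h => Nat.pair_lt_pair_right _ h
  exact (h1.monotone (by lia)).trans (h2.monotone hden)

theorem primrec_natCast_div : Primrec₂ fun a b : ℕ => (a : ℚ) / ((b + 1 : ℕ) : ℚ) := by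
  have hofNat : Primrec (ofNat ℚ) := Primrec.ofNat ℚ
  have hnum : Primrec fun k => (ofNat ℚ k).num := primrec_num.comp hofNat
  have hden : Primrec fun k => (ofNat ℚ k).den := primrec_den.comp hofNat
  have habs : Primrec fun k => (ofNat ℚ k).num.toNat := primrec_toNat.comp hnum
  have main : Primrec fun p : ℕ × ℕ => ratIndex ((p.1 : ℚ) / ((p.2 + 1 : ℕ) : ℚ)) := by
    refine Primrec.of_graph ⟨fun p : ℕ × ℕ => Nat.pair (2 * p.1) (p.2 + 1),
      Primrec₂.natPair.comp (Primrec.nat_double.comp .fst) (Primrec.succ.comp .snd), ?_⟩ ?_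
    · rintro ⟨a, b⟩
      exact (ratIndex_le_ratCode _).trans (ratCode_natCast_div_le a b)
    · refine PrimrecRel.of_eq (r := fun (p : ℕ × ℕ) k =>
        intCode (ofNat ℚ k).num % 2 = 0 ∧
        (ofNat ℚ k).num.toNat * (p.2 + 1) = p.1 * (ofNat ℚ k).den) (PrimrecPred.primrecRel
          (p := fun x : (ℕ × ℕ) × ℕ => intCode (ofNat ℚ x.2).num % 2 = 0 ∧
            (ofNat ℚ x.2).num.toNat * (x.1.2 + 1) = x.1.1 * (ofNat ℚ x.2).den)
          (PrimrecPred.and ?_ ?_)) ?_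
      · exact Primrec.eq.comp (Primrec.nat_mod.comp (primrec_intCode.comp
          (hnum.comp .snd)) (.const 2)) (.const 0)
      · exact Primrec.eq.comp (Primrec.nat_mul.comp (habs.comp Primrec.snd)
          (Primrec.succ.comp (Primrec.snd.comp .fst)))
          (Primrec.nat_mul.comp (Primrec.fst.comp .fst) (hden.comp .snd))
      · rintro ⟨a, b⟩ k
        have hk : k = ratIndex (ofNat ℚ k) := (encode_ofNat k).symm
        generalize ofNat ℚ k = q at hk
        subst hk
        have hinj : Function.Injective ratIndex :=
          @encode_injective ℚ Primcodable.toEncodable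
        rw [hinj.eq_iff, div_eq_iff (by positivity)]
        have hpos : (0 : ℚ) < q.den := by exact_mod_cast q.pos
        have heq : (a : ℚ) = q * ((b + 1 : ℕ) : ℚ) ↔ q.num * (b + 1 : ℕ) = a * q.den := by
          conv_lhs => rw [← Rat.num_div_den q, div_mul_eq_mul_div, eq_div_iff hpos.ne']
          exact ⟨fun h => by exact_mod_cast h.symm, fun h => by exact_mod_cast h.symm⟩
        rw [heq]
        rcases hn : q.num with m | m
        · simp only [Int.ofNat_eq_natCast, intCode_natCast]
          simp
          norm_cast
        · simp only [intCode_negSucc]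
          refine ⟨fun h => by lia, fun h => ?_⟩
          have h1 : Int.negSucc m * (b + 1 : ℕ) < 0 :=
            mul_neg_of_neg_of_pos (Int.negSucc_lt_zero m) (by lia)
          have h2 : (0 : ℤ) ≤ a * q.den := by positivity
          lia
  exact Primrec.encode_iff.1 main

end RatPrimrec

theorem length_take (X : ℕ → Bool) (n : ℕ) : (take X n).length = n := by simp [take]

theorem take_take (X : ℕ → Bool) {n m : ℕ} (h : n ≤ m) : (take X m).take n = take X n := by
  rw [take, ← List.map_take, List.take_range, min_eq_left h, take]

/-- The list of all binary strings of length `n`, in lexicographic order. -/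
def strings : ℕ → List (List Bool)
  | 0 => [[]]
  | n + 1 => (strings n).map (List.cons false) ++ (strings n).map (List.cons true)

theorem mem_strings {n : ℕ} {σ : List Bool} : σ ∈ strings n ↔ σ.length = n := by
  induction n generalizing σ with
  | zero => simp [strings]
  | succ n ih =>
    rcases σ with _ | ⟨b, σ⟩
    · simp [strings]
    · cases b <;> simp [strings, ih]

theorem length_strings (n : ℕ) : (strings n).length = 2 ^ n := by
  induction n with
  | zero => rfl
  | succ n ih => simp [strings, ih]; ring

theorem allStrings_perm (n : ℕ) : (allStrings n).Perm (strings n) := by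
  have hnd : (allStrings n).Nodup := by
    refine List.Nodup.map_on (fun x hx y hy h => ?_) List.nodup_range
    rw [List.mem_range] at hx hy
    refine Nat.eq_of_testBit_eq fun i => ?_
    by_cases hi : i < n
    · exact List.map_inj_left.1 h i (List.mem_range.2 hi)
    · have hp : 2 ^ n ≤ 2 ^ i := Nat.pow_le_pow_right (by norm_num) (by lia)
      rw [Nat.testBit_lt_two_pow (hx.trans_le hp), Nat.testBit_lt_two_pow (hy.trans_le hp)]
  have hsub : allStrings n ⊆ strings n := by
    intro σ hσ
    simp only [allStrings, List.mem_map] at hσ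
    obtain ⟨k, _, rfl⟩ := hσ
    simp [mem_strings]
  refine (List.subperm_of_subset hnd hsub).perm_of_length_le ?_
  simp [length_strings, allStrings]

/-- Whether `σ` extends a member of `G`. -/
def covers (G : List (List Bool)) (σ : List Bool) : Bool := G.any fun τ => decide (τ <+: σ)

theorem covers_iff {G : List (List Bool)} {σ : List Bool} :
    covers G σ = true ↔ ∃ τ ∈ G, τ <+: σ := by
  simp [covers]

theorem length_le_maxLen {G : List (List Bool)} {τ : List Bool} (h : τ ∈ G) :
    τ.length ≤ maxLen G := by
  induction G with
  | nil => simp at h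
  | cons a G ih =>
    have hc : maxLen (a :: G) = max a.length (maxLen G) := rfl
    rcases List.mem_cons.1 h with rfl | h
    · rw [hc]; exact le_max_left _ _
    · rw [hc]; exact (ih h).trans (le_max_right _ _)

theorem maxLen_le {G : List (List Bool)} {k : ℕ} (h : ∀ τ ∈ G, τ.length ≤ k) :
    maxLen G ≤ k := by
  induction G with
  | nil => exact Nat.zero_le _
  | cons a G ih =>
    exact max_le (h a (by simp)) (ih fun τ hτ => h τ (by simp [hτ]))

theorem covers_append {G : List (List Bool)} {σ : List Bool} (h : maxLen G ≤ σ.length)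
    (ρ : List Bool) : covers G (σ ++ ρ) = covers G σ := by
  rw [Bool.eq_iff_iff, covers_iff, covers_iff]
  constructor
  · rintro ⟨τ, hτ, hp⟩
    exact ⟨τ, hτ, List.prefix_of_prefix_length_le hp (List.prefix_append _ _)
      ((length_le_maxLen hτ).trans h)⟩
  · rintro ⟨τ, hτ, hp⟩
    exact ⟨τ, hτ, hp.trans (List.prefix_append _ _)⟩

/-- The number of extensions of `σ` by `k` bits that extend a member of `G`. -/
def extCount (G : List (List Bool)) (k : ℕ) (σ : List Bool) : ℕ :=
  (strings k).countP fun ρ => covers G (σ ++ ρ)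

theorem extCount_succ (G : List (List Bool)) (k : ℕ) (σ : List Bool) :
    extCount G (k + 1) σ = extCount G k (σ ++ [false]) + extCount G k (σ ++ [true]) := by
  simp [extCount, strings, List.countP_map, Function.comp_def]

theorem extCount_succ_eq_two_mul {G : List (List Bool)} {k : ℕ} {σ : List Bool}
    (h : maxLen G ≤ σ.length + k) : extCount G (k + 1) σ = 2 * extCount G k σ := by
  induction k generalizing σ with
  | zero =>
    rw [extCount_succ]
    simp [extCount, strings, covers_append (show maxLen G ≤ σ.length from h)]
    lia
  | succ k ih =>
    rw [extCount_succ, ih (by simp; lia), ih (by simp; lia), extCount_succ G k σ]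
    lia

/-- The uniform measure of `[G]` conditioned on `[σ]`. -/
def condMu (G : List (List Bool)) (σ : List Bool) : ℚ :=
  (extCount G (maxLen G) σ : ℚ) / 2 ^ maxLen G

theorem condMu_eq {G : List (List Bool)} {k : ℕ} (h : maxLen G ≤ k) (σ : List Bool) :
    condMu G σ = (extCount G k σ : ℚ) / 2 ^ k := by
  induction k, h using Nat.le_induction with
  | base => rfl
  | succ k hk ih =>
    rw [ih, extCount_succ_eq_two_mul (by lia), pow_succ]
    push_cast
    field_simp

theorem condMu_nonneg (G : List (List Bool)) (σ : List Bool) : 0 ≤ condMu G σ := by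
  unfold condMu; positivity

theorem condMu_nil (G : List (List Bool)) : condMu G [] = mu G := by
  rw [condMu, mu, extCount, ← List.countP_eq_length_filter, (allStrings_perm _).countP_eq]
  rfl

theorem condMu_add (G : List (List Bool)) (σ : List Bool) :
    condMu G (σ ++ [false]) + condMu G (σ ++ [true]) = 2 * condMu G σ := by
  rw [condMu, condMu, ← add_div, ← Nat.cast_add, ← extCount_succ,
    extCount_succ_eq_two_mul (by lia), condMu]
  push_cast
  ring

theorem condMu_append_singleton_le (G : List (List Bool)) (σ : List Bool) (b : Bool) :
    condMu G (σ ++ [b]) ≤ 2 * condMu G σ := by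
  rw [← condMu_add]
  cases b
  · linarith [condMu_nonneg G (σ ++ [true])]
  · linarith [condMu_nonneg G (σ ++ [false])]

theorem condMu_le (G : List (List Bool)) (σ : List Bool) :
    condMu G σ ≤ 2 ^ σ.length * mu G := by
  induction σ using List.reverseRecOn with
  | nil => simp [condMu_nil]
  | append_singleton σ b ih =>
    refine (condMu_append_singleton_le G σ b).trans ?_
    rw [List.length_append, List.length_singleton, pow_succ]
    linarith

theorem condMu_take_of_mem {X : ℕ → Bool} {G : List (List Bool)} (h : Mem X G) {N : ℕ}
    (hN : maxLen G ≤ N) : condMu G (take X N) = 1 := by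
  have hc : covers G (take X N) = true := by
    obtain ⟨τ, hτ, hX⟩ := h
    refine covers_iff.2 ⟨τ, hτ, ?_⟩
    rw [← hX, ← take_take X ((length_le_maxLen hτ).trans hN)]
    exact List.take_prefix _ _
  have he : extCount G (maxLen G) (take X N) = 2 ^ maxLen G := by
    rw [extCount, ← length_strings, List.countP_eq_length]
    intro ρ _
    rw [covers_append (by rwa [length_take]), hc]
  rw [condMu, he]
  push_cast
  exact div_self (by positivity)

theorem sum_strings_append {d : List Bool → ℚ} (hd : IsMartingale d) (k : ℕ) (σ : List Bool) :
    ((strings k).map fun ρ => d (σ ++ ρ)).sum = 2 ^ k * d σ := by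
  induction k generalizing σ with
  | zero => simp [strings]
  | succ k ih =>
    have h0 := ih (σ ++ [false])
    have h1 := ih (σ ++ [true])
    simp only [List.append_assoc, List.singleton_append] at h0 h1
    simp only [strings, List.map_append, List.map_map, Function.comp_def, List.sum_append, h0, h1]
    rw [hd.2.2 σ]
    ring

theorem countP_mul_le_sum (l : List (List Bool)) {d : List Bool → ℚ} (hd : ∀ σ, 0 ≤ d σ) (c : ℚ) :
    (l.countP fun σ => decide (c ≤ d σ)) * c ≤ (l.map d).sum := by
  induction l with
  | nil => simp
  | cons a l ih =>
    rw [List.map_cons, List.sum_cons, List.countP_cons]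
    have := hd a
    by_cases h : c ≤ d a
    · simp [h]; linarith
    · simp [h]; linarith

/-- The strings of length `k` at which `d` has value at least `c`. -/
def levelSet (d : List Bool → ℚ) (k : ℕ) (c : ℚ) : List (List Bool) :=
  (strings k).filter fun σ => decide (c ≤ d σ)

theorem mu_levelSet_le {d : List Bool → ℚ} (hd : IsMartingale d) (k : ℕ) {c : ℚ} (hc : 0 < c) :
    mu (levelSet d k c) ≤ c⁻¹ := by
  have hlen : ∀ τ ∈ levelSet d k c, τ.length = k := fun τ hτ =>
    mem_strings.1 (List.mem_filter.1 hτ).1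
  rw [← condMu_nil, condMu_eq (maxLen_le fun τ hτ => (hlen τ hτ).le) []]
  have he : extCount (levelSet d k c) k [] = (strings k).countP fun σ => decide (c ≤ d σ) := by
    refine List.countP_congr fun σ hσ => ?_
    rw [List.nil_append, covers_iff]
    constructor
    · rintro ⟨τ, hτ, hp⟩
      rw [← hp.eq_of_length ((hlen τ hτ).trans (mem_strings.1 hσ).symm)]
      exact (List.mem_filter.1 hτ).2
    · exact fun h => ⟨σ, List.mem_filter.2 ⟨hσ, h⟩, List.prefix_rfl⟩
  have hm := countP_mul_le_sum (strings k) hd.2.1 c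
  have hs := sum_strings_append hd k []
  simp only [List.nil_append, hd.1, mul_one] at hs
  rw [hs] at hm
  rw [he, div_le_iff₀ (by positivity), inv_mul_eq_div, le_div_iff₀ hc]
  exact hm

theorem mem_levelSet {d : List Bool → ℚ} {X : ℕ → Bool} {k : ℕ} {c : ℚ}
    (h : c ≤ d (take X k)) : Mem X (levelSet d k c) :=
  ⟨take X k, List.mem_filter.2 ⟨mem_strings.2 (length_take X k), by simpa using h⟩,
    by rw [length_take]⟩

theorem primrec_strings : Primrec strings := by
  have hcons : ∀ b : Bool, Primrec fun l : List (List Bool) => l.map (List.cons b) := fun b =>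
    Primrec.list_map .id (Primrec.list_cons.comp (.const b) .snd)
  refine (Primrec.nat_rec₁ (f := fun _ l => l.map (List.cons false) ++ l.map (List.cons true))
    [[]] (Primrec.list_append.comp ((hcons false).comp .snd) ((hcons true).comp .snd))).of_eq
    fun n => ?_
  induction n with
  | zero => rfl
  | succ n ih => simp only [strings, ← ih]

theorem primrec_nat_pow : Primrec₂ fun a b : ℕ => a ^ b :=
  Primrec₂.unpaired'.1 Nat.Primrec.pow

theorem primrec_maxLen : Primrec maxLen :=
  Primrec.list_foldr (Primrec.list_map .id (Primrec.list_length.comp Primrec.snd).to₂) (.const 0)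
    (Primrec.nat_max.comp (Primrec.fst.comp Primrec.snd) (Primrec.snd.comp Primrec.snd)).to₂

theorem primrec_sum_range {α : Type*} [Primcodable α] {f : α → ℕ → ℕ} {g : α → ℕ}
    (hf : Primrec₂ f) (hg : Primrec g) : Primrec fun a => ∑ i ∈ Finset.range (g a), f a i := by
  refine (Primrec.nat_rec' hg (.const 0) (h := fun a p => p.2 + f a p.1)
    (Primrec.nat_add.comp (Primrec.snd.comp .snd)
      (hf.comp .fst (Primrec.fst.comp .snd)))).of_eq fun a => ?_
  induction g a with
  | zero => rfl
  | succ n ih => rw [Finset.sum_range_succ, ← ih]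

theorem primrecRel_isPrefix : PrimrecRel fun τ σ : List Bool => τ <+: σ :=
  PrimrecRel.of_eq (r := fun τ σ : List Bool => τ = σ.take τ.length)
    (PrimrecPred.primrecRel (p := fun x : List Bool × List Bool => x.1 = x.2.take x.1.length)
      (Primrec.eq.comp .fst (Primrec.list_take.comp (Primrec.list_length.comp .fst) .snd)))
    fun _ _ => List.prefix_iff_eq_take.symm

theorem primrec_extCount :
    Primrec fun x : List (List Bool) × ℕ × List Bool => extCount x.1 x.2.1 x.2.2 := by
  have hcov : PrimrecRel fun (ρ : List Bool) (y : List (List Bool) × List Bool) =>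
      covers y.1 (y.2 ++ ρ) = true := by
    refine PrimrecRel.of_eq (r := fun (ρ : List Bool) (y : List (List Bool) × List Bool) =>
      ∃ τ ∈ y.1, τ <+: y.2 ++ ρ) (PrimrecPred.primrecRel
        (p := fun z : List Bool × List (List Bool) × List Bool =>
          ∃ τ ∈ z.2.1, τ <+: z.2.2 ++ z.1) ?_) fun _ _ => covers_iff.symm
    exact primrecRel_isPrefix.exists_mem_list.comp (Primrec.fst.comp .snd)
      (Primrec.list_append.comp (Primrec.snd.comp .snd) .fst)
  refine (Primrec.list_length.comp (hcov.listFilter.comp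
    (primrec_strings.comp (Primrec.fst.comp .snd))
    (Primrec.pair .fst (Primrec.snd.comp .snd)))).of_eq fun x => ?_
  rw [extCount, List.countP_eq_length_filter]
  simp

theorem primrec_levelSet {d : List Bool → ℚ} (hd : Primrec d) {f : ℕ → ℕ} (hf : Primrec f) :
    Primrec fun n => levelSet d (f n) (2 ^ n) := by
  have hR : PrimrecRel fun (σ : List Bool) (n : ℕ) => ((2 ^ n - 1 + 1 : ℕ) : ℚ) ≤ d σ :=
    primrecRel_natCast_le_of_pos.comp₂
      (Primrec.pred.comp (primrec_nat_pow.comp (.const 2) .snd)).to₂ (hd.comp .fst).to₂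
  refine (hR.listFilter.comp (primrec_strings.comp hf) .id).of_eq fun n => ?_
  rw [levelSet]
  refine List.filter_congr fun σ _ => ?_
  have : 2 ^ n - 1 + 1 = 2 ^ n := Nat.sub_add_cancel Nat.one_le_two_pow
  rw [id, this]
  simp

/-- The bet placed on the `n`-th member of the subsequence `G (3 n + 1)`,
which starts after `n` bits. -/
def bet (G : ℕ → List (List Bool)) (n : ℕ) (σ : List Bool) : ℚ :=
  2 ^ n * (condMu (G (3 * n + 1)) σ - condMu (G (3 * n + 1)) (σ.take n))

/-- The martingale that bets on all clopen sets `[G (3 n + 1)]`. -/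
def testMartingale (G : ℕ → List (List Bool)) (σ : List Bool) : ℚ :=
  1 + ∑ n ∈ Finset.range σ.length, bet G n σ

theorem bet_add (G : ℕ → List (List Bool)) {n : ℕ} {σ : List Bool} (h : n ≤ σ.length) :
    bet G n (σ ++ [false]) + bet G n (σ ++ [true]) = 2 * bet G n σ := by
  have := condMu_add (G (3 * n + 1)) σ
  rw [bet, bet, bet, List.take_append_of_le_length h, List.take_append_of_le_length h]
  linear_combination 2 ^ n * this

theorem sum_condMu_take_le {G : ℕ → List (List Bool)} (hG : IsTest G) (σ : List Bool) (k : ℕ) :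
    ∑ n ∈ Finset.range k, 2 ^ n * condMu (G (3 * n + 1)) (σ.take n) ≤ 1 := by
  have hb : ∀ n, 2 ^ n * condMu (G (3 * n + 1)) (σ.take n) ≤ (1 / 2 : ℚ) ^ (n + 1) := by
    intro n
    have h1 := condMu_le (G (3 * n + 1)) (σ.take n)
    have h2 : (2 : ℚ) ^ (σ.take n).length ≤ 2 ^ n :=
      pow_le_pow_right₀ (by norm_num) (List.length_take_le _ _)
    have h3 : condMu (G (3 * n + 1)) (σ.take n) ≤ 2 ^ n * ((2 : ℚ) ^ (3 * n + 1))⁻¹ :=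
      h1.trans ((mul_le_mul_of_nonneg_left (hG.2 _) (by positivity)).trans
        (mul_le_mul_of_nonneg_right h2 (by positivity)))
    refine (mul_le_mul_of_nonneg_left h3 (by positivity)).trans_eq ?_
    rw [show 3 * n + 1 = n + n + (n + 1) by ring, pow_add, pow_add, one_div, inv_pow]
    field_simp
  have hs : ∀ k, ∑ n ∈ Finset.range k, (1 / 2 : ℚ) ^ (n + 1) = 1 - (1 / 2) ^ k := by
    intro k
    induction k with
    | zero => simp
    | succ k ih => rw [Finset.sum_range_succ, ih]; ring
  refine (Finset.sum_le_sum fun n _ => hb n).trans ?_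
  rw [hs]
  have : (0 : ℚ) ≤ (1 / 2) ^ k := by positivity
  linarith

theorem testMartingale_eq (G : ℕ → List (List Bool)) (σ : List Bool) :
    testMartingale G σ = 1 + ∑ n ∈ Finset.range σ.length, 2 ^ n * condMu (G (3 * n + 1)) σ
      - ∑ n ∈ Finset.range σ.length, 2 ^ n * condMu (G (3 * n + 1)) (σ.take n) := by
  simp only [testMartingale, bet, mul_sub, Finset.sum_sub_distrib]
  ring

theorem testMartingale_nonneg {G : ℕ → List (List Bool)} (hG : IsTest G) (σ : List Bool) :
    0 ≤ testMartingale G σ := by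
  rw [testMartingale_eq]
  have h1 := sum_condMu_take_le hG σ σ.length
  have h2 : 0 ≤ ∑ n ∈ Finset.range σ.length, 2 ^ n * condMu (G (3 * n + 1)) σ :=
    Finset.sum_nonneg fun n _ => mul_nonneg (by positivity) (condMu_nonneg _ _)
  linarith

theorem isMartingale_testMartingale {G : ℕ → List (List Bool)} (hG : IsTest G) :
    IsMartingale (testMartingale G) := by
  refine ⟨by simp [testMartingale], testMartingale_nonneg hG, fun σ => ?_⟩
  have h : ∑ n ∈ Finset.range (σ.length + 1), (bet G n (σ ++ [false]) + bet G n (σ ++ [true])) =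
      2 * ∑ n ∈ Finset.range σ.length, bet G n σ := by
    rw [Finset.sum_congr rfl fun n hn =>
      bet_add G (Nat.lt_succ_iff.1 (Finset.mem_range.1 hn)), ← Finset.mul_sum,
      Finset.sum_range_succ]
    simp [bet]
  rw [Finset.sum_add_distrib] at h
  simp only [testMartingale, List.length_append, List.length_singleton]
  linarith

theorem le_testMartingale {G : ℕ → List (List Bool)} (hG : IsTest G) {X : ℕ → Bool} {n N : ℕ}
    (hX : Mem X (G (3 * n + 1))) (hN : maxLen (G (3 * n + 1)) ≤ N) (hn : n < N) :
    2 ^ n ≤ testMartingale G (take X N) := by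
  rw [testMartingale_eq, length_take]
  have h1 := sum_condMu_take_le hG (take X N) N
  have h2 := Finset.single_le_sum (s := Finset.range N)
    (f := fun n => 2 ^ n * condMu (G (3 * n + 1)) (take X N))
    (fun n _ => mul_nonneg (by positivity) (condMu_nonneg _ _)) (Finset.mem_range.2 hn)
  simp only [condMu_take_of_mem hX hN, mul_one] at h2
  linarith

/-- An exponent `k` such that `2 ^ k` is a denominator of `testMartingale G`
on strings of length `s`. -/
def denExp (G : ℕ → List (List Bool)) (s : ℕ) : ℕ :=
  ∑ n ∈ Finset.range s, maxLen (G (3 * n + 1))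

/-- The natural number `2 ^ n * condMu (G (3 * n + 1)) σ * 2 ^ denExp G s`, for `n < s`. -/
def scaledMu (G : ℕ → List (List Bool)) (σ : List Bool) (s n : ℕ) : ℕ :=
  2 ^ n * extCount (G (3 * n + 1)) (maxLen (G (3 * n + 1))) σ *
    2 ^ (denExp G s - maxLen (G (3 * n + 1)))

theorem scaledMu_cast (G : ℕ → List (List Bool)) (σ : List Bool) {s n : ℕ}
    (hn : n ∈ Finset.range s) : (scaledMu G σ s n : ℚ) =
      2 ^ n * condMu (G (3 * n + 1)) σ * 2 ^ denExp G s := by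
  have hle : maxLen (G (3 * n + 1)) ≤ denExp G s :=
    Finset.single_le_sum (f := fun n => maxLen (G (3 * n + 1))) (fun _ _ => Nat.zero_le _) hn
  have hp : (2 : ℚ) ^ denExp G s =
      2 ^ (denExp G s - maxLen (G (3 * n + 1))) * 2 ^ maxLen (G (3 * n + 1)) := by
    rw [← pow_add, Nat.sub_add_cancel hle]
  rw [hp, condMu, scaledMu]
  push_cast
  field_simp

/-- The scaled gains of `testMartingale G`. -/
def gain (G : ℕ → List (List Bool)) (σ : List Bool) : ℕ :=
  2 ^ denExp G σ.length + ∑ n ∈ Finset.range σ.length, scaledMu G σ σ.length n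

/-- The scaled losses of `testMartingale G`. -/
def loss (G : ℕ → List (List Bool)) (σ : List Bool) : ℕ :=
  ∑ n ∈ Finset.range σ.length, scaledMu G (σ.take n) σ.length n

theorem testMartingale_mul_two_pow (G : ℕ → List (List Bool)) (σ : List Bool) :
    testMartingale G σ * 2 ^ denExp G σ.length = (gain G σ : ℚ) - loss G σ := by
  rw [testMartingale_eq, gain, loss]
  push_cast
  rw [Finset.sum_congr rfl fun n hn => scaledMu_cast G σ hn,
    Finset.sum_congr rfl fun n hn => scaledMu_cast G (σ.take n) hn,
    ← Finset.sum_mul, ← Finset.sum_mul]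
  ring

theorem testMartingale_eq_div {G : ℕ → List (List Bool)} (hG : IsTest G) (σ : List Bool) :
    testMartingale G σ =
      ((gain G σ - loss G σ : ℕ) : ℚ) / (((2 ^ denExp G σ.length).pred + 1 : ℕ) : ℚ) := by
  have hden : (2 ^ denExp G σ.length).pred + 1 = 2 ^ denExp G σ.length :=
    Nat.sub_add_cancel Nat.one_le_two_pow
  have hd := testMartingale_mul_two_pow G σ
  have hle : loss G σ ≤ gain G σ := by
    have := mul_nonneg (testMartingale_nonneg hG σ)
      (by positivity : (0 : ℚ) ≤ 2 ^ denExp G σ.length)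
    rw [hd, sub_nonneg] at this
    exact_mod_cast this
  rw [hden, Nat.cast_sub hle, ← hd, Nat.cast_pow, Nat.cast_ofNat,
    mul_div_cancel_right₀ _ (by positivity)]

theorem primrec_subsequence {G : ℕ → List (List Bool)} (hG : Primrec G) :
    Primrec fun n => G (3 * n + 1) :=
  hG.comp (Primrec.succ.comp (Primrec.nat_mul.comp (.const 3) .id))

theorem primrec_denExp {G : ℕ → List (List Bool)} (hG : Primrec G) : Primrec (denExp G) :=
  primrec_sum_range (f := fun _ n => maxLen (G (3 * n + 1)))
    ((primrec_maxLen.comp (primrec_subsequence hG)).comp Primrec.snd).to₂ .id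

theorem primrec_scaledMu {G : ℕ → List (List Bool)} (hG : Primrec G) :
    Primrec fun x : List Bool × ℕ × ℕ => scaledMu G x.1 x.2.1 x.2.2 := by
  have pn : Primrec fun x : List Bool × ℕ × ℕ => x.2.2 := Primrec.snd.comp .snd
  have ps : Primrec fun x : List Bool × ℕ × ℕ => x.2.1 := Primrec.fst.comp .snd
  have pG : Primrec fun x : List Bool × ℕ × ℕ => G (3 * x.2.2 + 1) :=
    (primrec_subsequence hG).comp pn
  have pℓ : Primrec fun x : List Bool × ℕ × ℕ => maxLen (G (3 * x.2.2 + 1)) :=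
    primrec_maxLen.comp pG
  have pext : Primrec fun x : List Bool × ℕ × ℕ =>
      extCount (G (3 * x.2.2 + 1)) (maxLen (G (3 * x.2.2 + 1))) x.1 :=
    primrec_extCount.comp (pG.pair (pℓ.pair .fst))
  exact Primrec.nat_mul.comp (Primrec.nat_mul.comp (primrec_nat_pow.comp (.const 2) pn) pext)
    (primrec_nat_pow.comp (.const 2) (Primrec.nat_sub.comp ((primrec_denExp hG).comp ps) pℓ))

theorem primrec_two_pow_denExp {G : ℕ → List (List Bool)} (hG : Primrec G) :
    Primrec fun σ : List Bool => 2 ^ denExp G σ.length :=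
  primrec_nat_pow.comp (.const 2) ((primrec_denExp hG).comp Primrec.list_length)

theorem primrec_gain {G : ℕ → List (List Bool)} (hG : Primrec G) : Primrec (gain G) :=
  Primrec.nat_add.comp (primrec_two_pow_denExp hG)
    (primrec_sum_range (f := fun σ n => scaledMu G σ σ.length n)
      ((primrec_scaledMu hG).comp (Primrec.fst.pair
        ((Primrec.list_length.comp Primrec.fst).pair Primrec.snd))).to₂ Primrec.list_length)

theorem primrec_loss {G : ℕ → List (List Bool)} (hG : Primrec G) : Primrec (loss G) := by
  have ptake : Primrec fun x : List Bool × ℕ => x.1.take x.2 :=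
    Primrec.list_take.comp Primrec.snd Primrec.fst
  have parg : Primrec fun x : List Bool × ℕ => (x.1.take x.2, x.1.length, x.2) :=
    ptake.pair ((Primrec.list_length.comp Primrec.fst).pair Primrec.snd)
  have hterm : Primrec₂ fun (σ : List Bool) (n : ℕ) => scaledMu G (σ.take n) σ.length n :=
    ((primrec_scaledMu hG).comp parg).to₂
  exact primrec_sum_range hterm Primrec.list_length

theorem primrec_testMartingale {G : ℕ → List (List Bool)} (hG : IsTest G) :
    Primrec (testMartingale G) :=
  (primrec_natCast_div.comp (Primrec.nat_sub.comp (primrec_gain hG.1) (primrec_loss hG.1))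
    (Primrec.pred.comp (primrec_two_pow_denExp hG.1))).of_eq
      fun σ => (testMartingale_eq_div hG σ).symm

theorem stmt4 (X : ℕ → Bool) : MLBPRandom X ↔ MartingaleBPRandom X := by
  constructor
  · rintro hX ⟨d, hd, hm, f, hf, hs⟩
    obtain ⟨n, hn⟩ := hX (fun n => levelSet d (f n) (2 ^ n))
      ⟨primrec_levelSet hd hf, fun n => mu_levelSet_le hm _ (by positivity)⟩
    exact hn (mem_levelSet (hs n))
  · intro hX G hG
    by_contra! hall
    refine hX ⟨testMartingale G, primrec_testMartingale hG, isMartingale_testMartingale hG,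
      fun n => max (maxLen (G (3 * n + 1))) (n + 1), ?_, fun n =>
        le_testMartingale hG (hall _) (le_max_left _ _)
          (Nat.lt_of_succ_le (le_max_right _ _))⟩
    exact Primrec.nat_max.comp (primrec_maxLen.comp (primrec_subsequence hG.1)) Primrec.succ

end BP
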